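/- arXiv:1512.04493 — 2 statements merged into one kernel-verified Lean document; each statement's English description precedes it below -/
import Mathlib

section
/- Let (u₂, z₂) be a classical solution of the Stefan problem (see context), and define the distribution function U₂(t,x) := ∫_{z₂(t)}^x u₂(t,y) dy for x ≥ z₂(t), with the convention U₂(t,x) := 0 for x < z₂(t). Then for all t > 0 and all x ∈ ℝ (including x < z₂(t)): U₂(t,x) = ∫₀^∞ p(t, x−y) U₂(0,y) dy − ∫₀ᵗ p(t−s, x − z₂(s)) ds. -/
open MeasureTheory Real Set

/-- The heat kernel `p(t,x) = (2πt)^{-1/2} exp(-x²/(2t))`. -/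
noncomputable def heatK (t x : ℝ) : ℝ :=
  (Real.sqrt (2 * Real.pi * t))⁻¹ * Real.exp (-x ^ 2 / (2 * t))

/-- The Neumann heat kernel `p_N(t,y,x) = p(t,y-x) + p(t,y+x)`. -/
noncomputable def heatKN (t y x : ℝ) : ℝ := heatK t (y - x) + heatK t (y + x)

/-- The space-time domain `D = {(t,x) : t > 0, x ≥ z₂(t)}` of the Stefan problem. -/
def stefanDomain (z₂ : ℝ → ℝ) : Set (ℝ × ℝ) := {q : ℝ × ℝ | 0 < q.1 ∧ z₂ q.1 ≤ q.2}

/-- A classical solution `(u₂, z₂)` of the Stefan problem: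
`z₂` is `C¹` on `(0,∞)`, continuous on `[0,∞)`, nondecreasing, with `z₂(0) = 0`;
`u₂` is bounded and integrable on the closure of `D` (in particular integrable on each
slice `[z₂(t),∞)`), and extends to a `C²` function on a neighborhood of the closure of `D`;
`u₂` solves the heat equation `∂ₜu₂ = (1/2)∂ₓₓu₂` for `t > 0`, `x > z₂(t)`;
`u₂(t, z₂(t)) = 2` for all `t ≥ 0`; and the Stefan boundary condition
`2 z₂'(t) + (1/2)∂ₓu₂(t,z₂(t)) = 0` holds for all `t > 0`. -/
structure StefanSolution (z₂ : ℝ → ℝ) (u₂ : ℝ → ℝ → ℝ) : Prop where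
  z_contDiff : ContDiffOn ℝ 1 z₂ (Set.Ioi 0)
  z_cont : ContinuousOn z₂ (Set.Ici 0)
  z_mono : MonotoneOn z₂ (Set.Ici 0)
  z_init : z₂ 0 = 0
  u_bdd : ∃ M : ℝ, ∀ q ∈ closure (stefanDomain z₂), |u₂ q.1 q.2| ≤ M
  u_int : MeasureTheory.IntegrableOn (fun q : ℝ × ℝ => u₂ q.1 q.2) (closure (stefanDomain z₂))
  u_intSlice : ∀ t : ℝ, 0 ≤ t → MeasureTheory.IntegrableOn (u₂ t) (Set.Ici (z₂ t))
  u_smooth : ∃ V : Set (ℝ × ℝ), IsOpen V ∧ closure (stefanDomain z₂) ⊆ V ∧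
      ContDiffOn ℝ 2 (fun q : ℝ × ℝ => u₂ q.1 q.2) V
  heatEq : ∀ t > (0:ℝ), ∀ x : ℝ, z₂ t < x →
      deriv (fun τ : ℝ => u₂ τ x) t = (1 / 2) * deriv (deriv (u₂ t)) x
  bdryVal : ∀ t ≥ (0:ℝ), u₂ t (z₂ t) = 2
  stefanBC : ∀ t > (0:ℝ), 2 * deriv z₂ t + (1 / 2) * deriv (u₂ t) (z₂ t) = 0

/-- The tail distribution function `𝒰₂(t,x) = ∫ₓ^∞ u₂(t,y) dy`. -/
noncomputable def tailDist (u₂ : ℝ → ℝ → ℝ) (t x : ℝ) : ℝ := ∫ y in Set.Ioi x, u₂ t y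

/-- The distribution function `U₂(t,x) = ∫_{z₂(t)}^x u₂(t,y) dy` for `x ≥ z₂(t)`,
with the convention `U₂(t,x) = 0` for `x < z₂(t)`. -/
noncomputable def distFn (z₂ : ℝ → ℝ) (u₂ : ℝ → ℝ → ℝ) (t x : ℝ) : ℝ :=
  if z₂ t ≤ x then ∫ y in (z₂ t)..x, u₂ t y else 0

open Filter Topology

lemma heatK_nonneg (σ w : ℝ) : 0 ≤ heatK σ w := by
  unfold heatK; positivity

lemma heatK_neg (σ w : ℝ) : heatK σ (-w) = heatK σ w := by
  simp [heatK]

lemma heatK_eq_scale {σ : ℝ} (hσ : 0 < σ) (w : ℝ) :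
    heatK σ w = (√σ)⁻¹ * heatK 1 (w / √σ) := by
  have h1 : √(2 * π * σ) = √(2 * π * 1) * √σ := by
    rw [mul_one, Real.sqrt_mul (by positivity)]
  have h2 : -w ^ 2 / (2 * σ) = -(w / √σ) ^ 2 / (2 * 1) := by
    rw [div_pow, Real.sq_sqrt hσ.le]
    field_simp
  simp only [heatK]
  rw [h1, h2, mul_inv]
  ring

lemma continuous_heatK_one : Continuous (heatK 1) := by
  unfold heatK; fun_prop

lemma heatK_le_inv_sqrt {σ : ℝ} (hσ : 0 < σ) (w : ℝ) : heatK σ w ≤ (√σ)⁻¹ := by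
  have h1 : Real.exp (-w ^ 2 / (2 * σ)) ≤ 1 := by
    rw [Real.exp_le_one_iff, neg_div]
    have : 0 ≤ w ^ 2 / (2 * σ) := by positivity
    linarith
  have h2 : √σ ≤ √(2 * π * σ) := by
    apply Real.sqrt_le_sqrt
    nlinarith [Real.pi_gt_three]
  unfold heatK
  calc _ ≤ (√(2 * π * σ))⁻¹ * 1 := by gcongr
    _ ≤ (√σ)⁻¹ := by
      rw [mul_one]
      have : 0 < √σ := Real.sqrt_pos.2 hσ
      gcongr

/-- Polynomial decay of the heat kernel away from the origin. -/
lemma heatK_le_div_pow {σ w : ℝ} (hσ : 0 < σ) (hw : 0 < w) :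
    heatK σ w ≤ (√σ)⁻¹ * (8 * σ ^ 2 / w ^ 4) := by
  have h2 : √σ ≤ √(2 * π * σ) := by
    apply Real.sqrt_le_sqrt
    nlinarith [Real.pi_gt_three]
  have hs : 0 < √σ := Real.sqrt_pos.2 hσ
  have h3 : Real.exp (-w ^ 2 / (2 * σ)) ≤ 8 * σ ^ 2 / w ^ 4 := by
    have hv : 0 < w ^ 2 / (2 * σ) := by positivity
    have := Real.quadratic_le_exp_of_nonneg hv.le
    have h4 : (w ^ 2 / (2 * σ)) ^ 2 / 2 ≤ Real.exp (w ^ 2 / (2 * σ)) := by linarith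
    rw [neg_div, Real.exp_neg]
    calc _ ≤ ((w ^ 2 / (2 * σ)) ^ 2 / 2)⁻¹ := by gcongr
      _ = _ := by field_simp; ring
  unfold heatK
  gcongr

lemma integrable_heatK {σ : ℝ} (hσ : 0 < σ) : Integrable (heatK σ) := by
  have := (integrable_exp_neg_mul_sq (b := 1 / (2 * σ)) (by positivity)).const_mul
    (√(2 * π * σ))⁻¹
  refine this.congr (ae_of_all _ fun w => ?_)
  simp only [heatK]
  congr 2
  ring

lemma integral_heatK_one_Ioi : ∫ w in Ioi (0 : ℝ), heatK 1 w = 1 / 2 := by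
  have h := integral_gaussian_Ioi (1 / 2)
  have h2 : ∀ w : ℝ, heatK 1 w = (√(2 * π))⁻¹ * Real.exp (-(1 / 2) * w ^ 2) := by
    intro w
    simp only [heatK, mul_one]
    congr 2
    ring
  simp only [h2]
  rw [integral_const_mul, h, show π / (1 / 2) = 2 * π by ring]
  have : √(2 * π) ≠ 0 := by positivity
  field_simp

/-- The primitive `v ↦ ∫₀^v p(1,w) dw` of the standard Gaussian density. -/
noncomputable def gaussPrim (v : ℝ) : ℝ := ∫ w in (0 : ℝ)..v, heatK 1 w

lemma hasDerivAt_gaussPrim (v : ℝ) : HasDerivAt gaussPrim (heatK 1 v) v :=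
  intervalIntegral.integral_hasDerivAt_right (continuous_heatK_one.intervalIntegrable _ _)
    (continuous_heatK_one.stronglyMeasurableAtFilter _ _) continuous_heatK_one.continuousAt

lemma continuous_gaussPrim : Continuous gaussPrim :=
  continuous_iff_continuousAt.2 fun v => (hasDerivAt_gaussPrim v).continuousAt

lemma gaussPrim_neg (v : ℝ) : gaussPrim (-v) = -gaussPrim v := by
  have h := intervalIntegral.integral_comp_neg (a := 0) (b := v) (heatK 1)
  simp only [heatK_neg, neg_zero] at h
  rw [gaussPrim, gaussPrim, h, intervalIntegral.integral_symm]

lemma tendsto_gaussPrim_atTop : Tendsto gaussPrim atTop (𝓝 (1 / 2)) := by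
  rw [← integral_heatK_one_Ioi]
  exact intervalIntegral_tendsto_integral_Ioi 0 (integrable_heatK one_pos).integrableOn tendsto_id

lemma tendsto_gaussPrim_atBot : Tendsto gaussPrim atBot (𝓝 (-(1 / 2))) := by
  have h := (tendsto_gaussPrim_atTop.comp tendsto_neg_atBot_atTop).neg
  refine h.congr fun v => ?_
  simp [gaussPrim_neg]

lemma abs_gaussPrim_le (v : ℝ) : |gaussPrim v| ≤ 1 / 2 := by
  have hm : Monotone gaussPrim := monotone_of_deriv_nonneg
    (fun v => (hasDerivAt_gaussPrim v).differentiableAt)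
    (fun v => by rw [(hasDerivAt_gaussPrim v).deriv]; exact heatK_nonneg _ _)
  exact abs_le.2 ⟨hm.le_of_tendsto tendsto_gaussPrim_atBot v,
    hm.ge_of_tendsto tendsto_gaussPrim_atTop v⟩

/-- Closed form of `∫_y^R p(t-s, x-w) dw` for `s < t`. -/
noncomputable def heatMass (t x R s y : ℝ) : ℝ :=
  gaussPrim ((R - x) / √(t - s)) - gaussPrim ((y - x) / √(t - s))

lemma abs_heatMass_le (t x R s y : ℝ) : |heatMass t x R s y| ≤ 1 := by
  have h1 := abs_le.1 (abs_gaussPrim_le ((R - x) / √(t - s)))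
  have h2 := abs_le.1 (abs_gaussPrim_le ((y - x) / √(t - s)))
  unfold heatMass
  exact abs_le.2 ⟨by linarith, by linarith⟩

lemma heatMass_self (t x R s : ℝ) : heatMass t x R s R = 0 := sub_self _

lemma hasDerivAt_heatMass_right (t x R : ℝ) {s : ℝ} (hs : s < t) (y : ℝ) :
    HasDerivAt (heatMass t x R s) (-heatK (t - s) (x - y)) y := by
  have h1 : HasDerivAt (fun y => (y - x) / √(t - s)) (1 / √(t - s)) y :=
    ((hasDerivAt_id y).sub_const x).div_const _
  have h2 := ((hasDerivAt_gaussPrim _).comp y h1).const_sub (gaussPrim ((R - x) / √(t - s)))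
  refine h2.congr_deriv ?_
  rw [← heatK_neg (t - s) (x - y), heatK_eq_scale (sub_pos.2 hs), neg_sub]
  ring

lemma hasDerivAt_gaussPrim_scale {t s : ℝ} (hs : s < t) (w : ℝ) :
    HasDerivAt (fun s => gaussPrim (w / √(t - s)))
      (1 / 2 * (w / (t - s) * heatK (t - s) w)) s := by
  have hp : 0 < t - s := sub_pos.2 hs
  have hq : 0 < √(t - s) := Real.sqrt_pos.2 hp
  have h1 : HasDerivAt (fun s => √(t - s)) (-1 / (2 * √(t - s))) s :=
    ((hasDerivAt_id s).const_sub t).sqrt hp.ne'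
  have h2 : HasDerivAt (fun s => w / √(t - s)) _ s := (hasDerivAt_const s w).div h1 hq.ne'
  refine ((hasDerivAt_gaussPrim _).comp s h2).congr_deriv ?_
  rw [heatK_eq_scale hp, Real.sq_sqrt hp.le]
  field_simp
  ring

lemma hasDerivAt_heatMass_left (t x R : ℝ) {s : ℝ} (hs : s < t) (y : ℝ) :
    HasDerivAt (fun s => heatMass t x R s y)
      (1 / 2 * ((x - y) / (t - s) * heatK (t - s) (x - y))
        - 1 / 2 * ((x - R) / (t - s) * heatK (t - s) (x - R))) s := by
  refine ((hasDerivAt_gaussPrim_scale hs (R - x)).sub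
    (hasDerivAt_gaussPrim_scale hs (y - x))).congr_deriv ?_
  rw [← heatK_neg _ (R - x), ← heatK_neg _ (y - x), neg_sub, neg_sub]
  ring

lemma hasDerivAt_heatK_sub {σ : ℝ} (hσ : 0 < σ) (x y : ℝ) :
    HasDerivAt (fun y => heatK σ (x - y)) ((x - y) / σ * heatK σ (x - y)) y := by
  have h1 : HasDerivAt (fun y : ℝ => -(x - y) ^ 2 / (2 * σ)) ((x - y) / σ) y := by
    refine (((((hasDerivAt_id y).const_sub x).pow 2).neg).div_const (2 * σ)).congr_deriv ?_
    simp only [id]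
    field_simp
    ring
  refine ((h1.exp).const_mul (√(2 * π * σ))⁻¹).congr_deriv ?_
  simp only [heatK]
  ring

lemma continuousOn_heatK :
    ContinuousOn (fun q : ℝ × ℝ => heatK q.1 q.2) {q | 0 < q.1} := by
  unfold heatK
  refine ContinuousOn.mul (ContinuousOn.inv₀ (by fun_prop) ?_) (ContinuousOn.rexp
    (ContinuousOn.div (by fun_prop) (by fun_prop) ?_))
  · intro q hq
    have : 0 < q.1 := hq
    positivity
  · intro q hq
    have : 0 < q.1 := hq
    positivity

lemma continuousOn_heatMass (t x R : ℝ) :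
    ContinuousOn (fun q : ℝ × ℝ => heatMass t x R q.1 q.2) {q | q.1 < t} := by
  have h : ∀ q ∈ {q : ℝ × ℝ | q.1 < t}, √(t - q.1) ≠ 0 := fun q hq =>
    (Real.sqrt_pos.2 (sub_pos.2 hq)).ne'
  unfold heatMass
  exact (continuous_gaussPrim.comp_continuousOn (ContinuousOn.div (by fun_prop) (by fun_prop) h)).sub
    (continuous_gaussPrim.comp_continuousOn (ContinuousOn.div (by fun_prop) (by fun_prop) h))

/-- As `s ↑ t`, the heat mass of `[y, R]` concentrates at `x`. -/
lemma tendsto_heatMass {t x R y : ℝ} (hR : x < R) (hy : y ≠ x) :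
    Tendsto (fun s => heatMass t x R s y) (𝓝[<] t) (𝓝 (if y < x then 1 else 0)) := by
  have h0 : Tendsto (fun s => √(t - s)) (𝓝[<] t) (𝓝[>] 0) := by
    refine tendsto_nhdsWithin_iff.2 ⟨?_, ?_⟩
    · have : Continuous fun s => √(t - s) := by fun_prop
      have h := this.tendsto t
      simp only [sub_self, Real.sqrt_zero] at h
      exact h.mono_left nhdsWithin_le_nhds
    · filter_upwards [self_mem_nhdsWithin] with s hs
      exact Real.sqrt_pos.2 (sub_pos.2 hs)
  have h1 := h0.inv_tendsto_nhdsGT_zero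
  have h2 : Tendsto (fun s => gaussPrim ((R - x) / √(t - s))) (𝓝[<] t) (𝓝 (1 / 2)) :=
    tendsto_gaussPrim_atTop.comp (h1.const_mul_atTop (sub_pos.2 hR))
  rcases hy.lt_or_gt with hy | hy
  · have h3 : Tendsto (fun s => gaussPrim ((y - x) / √(t - s))) (𝓝[<] t) (𝓝 (-(1 / 2))) :=
      tendsto_gaussPrim_atBot.comp (h1.const_mul_atTop_of_neg (sub_neg.2 hy))
    rw [if_pos hy, show (1 : ℝ) = 1 / 2 - -(1 / 2) by norm_num]
    exact h2.sub h3
  · have h3 : Tendsto (fun s => gaussPrim ((y - x) / √(t - s))) (𝓝[<] t) (𝓝 (1 / 2)) :=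
      tendsto_gaussPrim_atTop.comp (h1.const_mul_atTop (sub_pos.2 hy))
    rw [if_neg (not_lt.2 hy.le), show (0 : ℝ) = 1 / 2 - 1 / 2 by norm_num]
    exact h2.sub h3

/-- Leibniz rule for an integral with a moving lower endpoint. -/
lemma hasDerivAt_integral_moving_lower {g g' : ℝ → ℝ → ℝ} {W : Set (ℝ × ℝ)} (hW : IsOpen W)
    {a : ℝ → ℝ} {a' s₀ R : ℝ} (ha : HasDerivAt a a' s₀) (hR : a s₀ ≤ R)
    (hseg : ∀ y ∈ Icc (a s₀) R, (s₀, y) ∈ W)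
    (hg : ContinuousOn (fun q : ℝ × ℝ => g q.1 q.2) W)
    (hg' : ContinuousOn (fun q : ℝ × ℝ => g' q.1 q.2) W)
    (hderiv : ∀ q ∈ W, HasDerivAt (fun s => g s q.2) (g' q.1 q.2) q.1) :
    HasDerivAt (fun s => ∫ y in a s..R, g s y)
      (-(a' * g s₀ (a s₀)) + ∫ y in a s₀..R, g' s₀ y) s₀ := by
  obtain ⟨δ, hδ, hsub⟩ := (isCompact_singleton (x := s₀) |>.prod
    (isCompact_Icc (a := a s₀) (b := R))).exists_cthickening_subset_open hW (by
      rintro ⟨s, y⟩ ⟨rfl, hy⟩; exact hseg y hy)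
  have hbox : ∀ s y, |s - s₀| ≤ δ → y ∈ Icc (a s₀ - δ) (R + δ) → (s, y) ∈ W := by
    intro s y hs hy
    apply hsub
    refine Metric.mem_cthickening_of_dist_le (s, y) (s₀, max (a s₀) (min y R)) δ _ ?_ ?_
    · exact ⟨rfl, le_max_left _ _, max_le hR (min_le_right _ _)⟩
    · rw [Prod.dist_eq]
      refine max_le hs ?_
      rw [Real.dist_eq, abs_le]
      rcases max_cases (a s₀) (min y R) with ⟨h, _⟩ | ⟨h, _⟩ <;>
      rcases min_cases y R with ⟨h', _⟩ | ⟨h', _⟩ <;> rw [h] <;> constructor <;>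
        linarith [hy.1, hy.2]
  have hslice : ∀ {k : ℝ → ℝ → ℝ}, ContinuousOn (fun q : ℝ × ℝ => k q.1 q.2) W → ∀ s,
      |s - s₀| ≤ δ → ContinuousOn (k s) (Icc (a s₀ - δ) (R + δ)) := by
    intro k hk s hs
    exact hk.comp (f := fun y => (s, y)) (by fun_prop) fun y hy => hbox s y hs hy
  have hK : IsCompact (Icc (s₀ - δ) (s₀ + δ) ×ˢ Icc (a s₀ - δ) (R + δ)) :=
    isCompact_Icc.prod isCompact_Icc
  have hKW : Icc (s₀ - δ) (s₀ + δ) ×ˢ Icc (a s₀ - δ) (R + δ) ⊆ W := by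
    rintro ⟨s, y⟩ ⟨hs, hy⟩
    exact hbox s y (abs_le.2 ⟨by linarith [hs.1], by linarith [hs.2]⟩) hy
  obtain ⟨C, hC⟩ := hK.exists_bound_of_continuousOn (hg'.mono hKW)
  have hIoc : uIoc (a s₀) R ⊆ Icc (a s₀ - δ) (R + δ) := by
    rw [uIoc_of_le hR]
    intro y hy
    exact ⟨by linarith [hy.1], by linarith [hy.2]⟩
  have hmem : ∀ᶠ s in 𝓝 s₀, |s - s₀| ≤ δ := by
    filter_upwards [Metric.closedBall_mem_nhds s₀ hδ] with s hs
    exact hs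
  have h0 : |s₀ - s₀| ≤ δ := by simpa using hδ.le
  have hint : ∀ s, |s - s₀| ≤ δ → ∀ b c, b ∈ Icc (a s₀ - δ) (R + δ) →
      c ∈ Icc (a s₀ - δ) (R + δ) → IntervalIntegrable (g s) volume b c := by
    intro s hs b c hb hc
    exact ((hslice hg s hs).mono (uIcc_subset_Icc hb hc)).intervalIntegrable
  have ha0 : a s₀ ∈ Icc (a s₀ - δ) (R + δ) := ⟨by linarith, by linarith⟩
  have hRm : R ∈ Icc (a s₀ - δ) (R + δ) := ⟨by linarith, by linarith⟩
  have hfix : HasDerivAt (fun s => ∫ y in a s₀..R, g s y) (∫ y in a s₀..R, g' s₀ y) s₀ := by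
    refine (intervalIntegral.hasDerivAt_integral_of_dominated_loc_of_deriv_le (F := g) (F' := g')
      (bound := fun _ => C) (Metric.closedBall_mem_nhds s₀ hδ) ?_ (hint s₀ h0 _ _ ha0 hRm) ?_ ?_
      (by simp) ?_).2
    · filter_upwards [hmem] with s hs
      exact ((hslice hg s hs).mono hIoc).aestronglyMeasurable measurableSet_uIoc
    · exact ((hslice hg' s₀ h0).mono hIoc).aestronglyMeasurable measurableSet_uIoc
    · refine ae_of_all _ fun y hy s hs => hC (s, y) ⟨?_, hIoc hy⟩
      rw [Metric.mem_closedBall, Real.dist_eq, abs_le] at hs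
      exact ⟨by linarith [hs.1], by linarith [hs.2]⟩
    · exact ae_of_all _ fun y hy s hs => hderiv (s, y) (hbox s y hs (hIoc hy))
  have hmove : HasDerivAt (fun s => ∫ y in a s..a s₀, g s y) (-(a' * g s₀ (a s₀))) s₀ := by
    have hcont : ContinuousAt (fun q : ℝ × ℝ => g q.1 q.2) (s₀, a s₀) :=
      hg.continuousAt (hW.mem_nhds (hseg _ ⟨le_rfl, hR⟩))
    have hlin : HasDerivAt (fun s => -((a s - a s₀) * g s₀ (a s₀))) (-(a' * g s₀ (a s₀))) s₀ :=
      ((ha.sub_const _).mul_const _).neg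
    have herr : (fun s => (∫ y in a s..a s₀, g s y) - (-((a s - a s₀) * g s₀ (a s₀))))
        =o[𝓝 s₀] fun s => s - s₀ := by
      refine Asymptotics.IsLittleO.trans_isBigO (g := fun s => a s - a s₀) ?_ ha.isBigO_sub
      rw [Asymptotics.isLittleO_iff]
      intro ε hε
      obtain ⟨η, hη, hclose⟩ := Metric.continuousAt_iff.1 hcont ε hε
      have hat : ∀ᶠ s in 𝓝 s₀, |a s - a s₀| < min η δ :=
        ha.continuousAt.eventually (Metric.ball_mem_nhds _ (lt_min hη hδ))
      have hst : ∀ᶠ s in 𝓝 s₀, |s - s₀| < η := Metric.ball_mem_nhds _ hη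
      filter_upwards [hat, hst, hmem] with s h1 h2 h3
      have h4 := abs_lt.1 (h1.trans_le (min_le_right _ _))
      have has : a s ∈ Icc (a s₀ - δ) (R + δ) := ⟨by linarith, by linarith⟩
      have hrw : (∫ y in a s..a s₀, g s y) - (-((a s - a s₀) * g s₀ (a s₀)))
          = ∫ y in a s..a s₀, (g s y - g s₀ (a s₀)) := by
        rw [intervalIntegral.integral_sub (hint s h3 _ _ has ha0) (by simp)]
        simp only [intervalIntegral.integral_const, smul_eq_mul]
        ring
      rw [hrw, Real.norm_eq_abs (a s - a s₀), abs_sub_comm (a s)]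
      refine intervalIntegral.norm_integral_le_of_norm_le_const fun y hy => ?_
      have hy' : |y - a s₀| ≤ |a s - a s₀| :=
        abs_sub_left_of_mem_uIcc (by rw [uIcc_comm]; exact uIoc_subset_uIcc hy)
      have := hclose (x := (s, y)) (by
        rw [Prod.dist_eq]
        exact max_lt h2 ((hy'.trans_lt h1).trans_le (min_le_left _ _)))
      exact this.le
    rw [hasDerivAt_iff_isLittleO] at hlin ⊢
    refine (herr.add hlin).congr_left fun s => ?_
    simp
  refine (hmove.add hfix).congr_of_eventuallyEq ?_
  have hat : ∀ᶠ s in 𝓝 s₀, |a s - a s₀| < δ :=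
    ha.continuousAt.eventually (Metric.ball_mem_nhds _ hδ)
  filter_upwards [hat, hmem] with s h1 h3
  have h4 := abs_lt.1 h1
  exact (intervalIntegral.integral_add_adjacent_intervals
    (hint s h3 _ _ ⟨by linarith, by linarith⟩ ha0) (hint s h3 _ _ ha0 hRm)).symm

lemma exists_continuousOn_partials {u : ℝ → ℝ → ℝ} {V : Set (ℝ × ℝ)} (hV : IsOpen V)
    (hu : ContDiffOn ℝ 2 (fun q : ℝ × ℝ => u q.1 q.2) V) :
    ∃ uₜ uₓ uₓₓ : ℝ → ℝ → ℝ,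
      ContinuousOn (fun q : ℝ × ℝ => uₜ q.1 q.2) V ∧
      ContinuousOn (fun q : ℝ × ℝ => uₓ q.1 q.2) V ∧
      ContinuousOn (fun q : ℝ × ℝ => uₓₓ q.1 q.2) V ∧
      ∀ q ∈ V, HasDerivAt (fun s => u s q.2) (uₜ q.1 q.2) q.1 ∧
        HasDerivAt (u q.1) (uₓ q.1 q.2) q.2 ∧ HasDerivAt (uₓ q.1) (uₓₓ q.1 q.2) q.2 := by
  set w : ℝ × ℝ → ℝ := fun q => u q.1 q.2
  have hD : ContDiffOn ℝ 1 (fderiv ℝ w) V := hu.fderiv_of_isOpen hV (by norm_num)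
  have hX : ContDiffOn ℝ 1 (fun q => fderiv ℝ w q (0, 1)) V := hD.clm_apply contDiffOn_const
  have hXD := hX.continuousOn_fderiv_of_isOpen hV le_rfl
  refine ⟨fun s y => fderiv ℝ w (s, y) (1, 0), fun s y => fderiv ℝ w (s, y) (0, 1),
    fun s y => fderiv ℝ (fun q => fderiv ℝ w q (0, 1)) (s, y) (0, 1),
    hD.continuousOn.clm_apply continuousOn_const, hX.continuousOn,
    hXD.clm_apply continuousOn_const, fun q hq => ?_⟩
  have hw : HasFDerivAt w (fderiv ℝ w q) q :=
    ((hu.differentiableOn (by norm_num)).differentiableAt (hV.mem_nhds hq)).hasFDerivAt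
  have hx := ((hX.differentiableOn (by norm_num)).differentiableAt (hV.mem_nhds hq)).hasFDerivAt
  have h1 : HasDerivAt (fun s : ℝ => (s, q.2)) ((1 : ℝ), (0 : ℝ)) q.1 :=
    (hasDerivAt_id q.1).prodMk (hasDerivAt_const q.1 q.2)
  have h2 : HasDerivAt (fun y : ℝ => (q.1, y)) ((0 : ℝ), (1 : ℝ)) q.2 :=
    (hasDerivAt_const q.2 q.1).prodMk (hasDerivAt_id q.2)
  exact ⟨HasFDerivAt.comp_hasDerivAt (f := fun s : ℝ => (s, q.2)) q.1 hw h1,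
    HasFDerivAt.comp_hasDerivAt (f := fun y : ℝ => (q.1, y)) q.2 hw h2,
    HasFDerivAt.comp_hasDerivAt (f := fun y : ℝ => (q.1, y)) q.2 hx h2⟩

namespace StefanSolution

variable {z₂ : ℝ → ℝ} {u₂ : ℝ → ℝ → ℝ}

lemma z_nonneg (h : StefanSolution z₂ u₂) {s : ℝ} (hs : 0 ≤ s) : 0 ≤ z₂ s := by
  rw [← h.z_init]
  exact h.z_mono self_mem_Ici hs hs

lemma mem_closure (h : StefanSolution z₂ u₂) {s y : ℝ} (hs : 0 ≤ s) (hy : z₂ s ≤ y) :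
    (s, y) ∈ closure (stefanDomain z₂) := by
  have hc : Tendsto (fun r => (r, z₂ r + (y - z₂ s))) (𝓝[>] s) (𝓝 (s, z₂ s + (y - z₂ s))) := by
    have hz : Tendsto z₂ (𝓝[>] s) (𝓝 (z₂ s)) :=
      (h.z_cont s hs).mono_left (nhdsWithin_mono s fun r hr => hs.trans (le_of_lt hr))
    exact (tendsto_id.mono_left nhdsWithin_le_nhds).prodMk_nhds (hz.add_const _)
  rw [add_sub_cancel] at hc
  refine mem_closure_of_tendsto hc ?_
  filter_upwards [self_mem_nhdsWithin] with r hr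
  exact ⟨hs.trans_lt hr, by simpa using hy⟩

lemma continuousAt_u (h : StefanSolution z₂ u₂) {s y : ℝ} (hs : 0 ≤ s) (hy : z₂ s ≤ y) :
    ContinuousAt (fun q : ℝ × ℝ => u₂ q.1 q.2) (s, y) := by
  obtain ⟨V, hV, hsub, hu⟩ := h.u_smooth
  exact hu.continuousOn.continuousAt (hV.mem_nhds (hsub (h.mem_closure hs hy)))

lemma continuousAt_slice (h : StefanSolution z₂ u₂) {s y : ℝ} (hs : 0 ≤ s) (hy : z₂ s ≤ y) :
    ContinuousAt (u₂ s) y :=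
  (h.continuousAt_u hs hy).comp (f := fun y => (s, y)) (by fun_prop)

lemma continuousOn_slice (h : StefanSolution z₂ u₂) {s : ℝ} (hs : 0 ≤ s) :
    ContinuousOn (u₂ s) (Ici (z₂ s)) :=
  fun _ hy => (h.continuousAt_slice hs hy).continuousWithinAt

/-- Continuity in time of weighted integrals of `u₂` over `[z₂(s), R]`. -/
lemma tendsto_integral_mul (h : StefanSolution z₂ u₂) {t₀ R c : ℝ} (ht₀ : 0 ≤ t₀)
    (hR : z₂ t₀ < R) {l : Filter ℝ} [l.IsCountablyGenerated] (hl : l ≤ 𝓝[Ici 0] t₀)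
    {k : ℝ → ℝ → ℝ} {k₀ : ℝ → ℝ} (hkc : ∀ᶠ s in l, Continuous (k s))
    (hkb : ∀ s y, |k s y| ≤ 1) (hk : ∀ y, y ≠ c → Tendsto (fun s => k s y) l (𝓝 (k₀ y))) :
    Tendsto (fun s => ∫ y in z₂ s..R, k s y * u₂ s y) l
      (𝓝 (∫ y in z₂ t₀..R, k₀ y * u₂ t₀ y)) := by
  obtain ⟨M, hM⟩ := h.u_bdd
  have hz : Tendsto z₂ l (𝓝 (z₂ t₀)) := (h.z_cont t₀ ht₀).mono_left hl
  have hid : Tendsto id l (𝓝 t₀) := hl.trans nhdsWithin_le_nhds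
  have hpos : ∀ᶠ s in l, 0 ≤ s := hl self_mem_nhdsWithin
  have hzR : ∀ᶠ s in l, z₂ s < R := hz.eventually_lt_const hR
  have hset : ∀ (s : ℝ) (f : ℝ → ℝ), z₂ s ≤ R →
      ∫ y in z₂ s..R, f y = ∫ y, (Ioc (z₂ s) R).indicator f y := by
    intro s f hs
    rw [intervalIntegral.integral_of_le hs, integral_indicator measurableSet_Ioc]
  rw [hset t₀ _ hR.le]
  refine Tendsto.congr' (f₁ := fun s => ∫ y, (Ioc (z₂ s) R).indicator
    (fun y => k s y * u₂ s y) y) ?_ ?_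
  · filter_upwards [hzR] with s hs
    exact (hset s _ hs.le).symm
  refine tendsto_integral_filter_of_dominated_convergence
    (fun y => (Ioc 0 R).indicator (fun _ => M) y) ?_ ?_ ?_ ?_
  · filter_upwards [hpos, hkc] with s hs hc
    rw [aestronglyMeasurable_indicator_iff measurableSet_Ioc]
    exact (hc.continuousOn.mul ((h.continuousOn_slice hs).mono
      fun y hy => hy.1.le)).aestronglyMeasurable measurableSet_Ioc
  · filter_upwards [hpos] with s hs
    refine ae_of_all _ fun y => ?_
    by_cases hy : y ∈ Ioc (z₂ s) R
    · have hu := hM (s, y) (h.mem_closure hs hy.1.le)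
      rw [indicator_of_mem hy, indicator_of_mem
        (show y ∈ Ioc 0 R from ⟨(h.z_nonneg hs).trans_lt hy.1, hy.2⟩), Real.norm_eq_abs, abs_mul]
      calc |k s y| * |u₂ s y| ≤ 1 * M := by
            gcongr
            · exact hkb s y
        _ = M := one_mul M
    · rw [indicator_of_notMem hy, norm_zero]
      exact indicator_nonneg (fun _ _ => (abs_nonneg _).trans
        (hM (t₀, z₂ t₀) (h.mem_closure ht₀ le_rfl))) y
  · rw [integrable_indicator_iff measurableSet_Ioc]
    simp
  · have hae : ∀ᵐ y : ℝ, y ≠ c ∧ y ≠ z₂ t₀ :=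
      (Measure.ae_ne volume c).and (Measure.ae_ne volume (z₂ t₀))
    filter_upwards [hae] with y ⟨hyc, hyz⟩
    by_cases hyR : y ≤ R
    · rcases hyz.lt_or_gt with hy | hy
      · rw [indicator_of_notMem (fun hm => (hm.1.trans hy).false)]
        refine tendsto_const_nhds.congr' ?_
        filter_upwards [hz.eventually_const_lt hy] with s hs
        rw [indicator_of_notMem (fun hm => (hm.1.trans hs).false)]
      · rw [indicator_of_mem (show y ∈ Ioc (z₂ t₀) R from ⟨hy, hyR⟩)]
        have hu : Tendsto (fun s => u₂ s y) l (𝓝 (u₂ t₀ y)) :=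
          (h.continuousAt_u ht₀ hy.le).tendsto.comp (hid.prodMk_nhds tendsto_const_nhds)
        refine ((hk y hyc).mul hu).congr' ?_
        filter_upwards [hz.eventually_lt_const hy] with s hs
        rw [indicator_of_mem (show y ∈ Ioc (z₂ s) R from ⟨hs, hyR⟩)]
    · simp only [indicator_of_notMem (fun hm : y ∈ Ioc _ R => hyR hm.2)]
      exact tendsto_const_nhds

/-- Evolution of the heat-weighted mass of `u₂` on `[z₂(s), R]`. -/
lemma hasDerivAt_integral_heatMass (h : StefanSolution z₂ u₂) {t x R s : ℝ} (hs : 0 < s)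
    (hst : s < t) (hR : z₂ s < R) :
    HasDerivAt (fun s => ∫ y in z₂ s..R, heatMass t x R s y * u₂ s y)
      (1 / 2 * (heatK (t - s) (x - R) * u₂ s R)
        - 1 / 2 * ((x - R) / (t - s) * heatK (t - s) (x - R)) * (∫ y in z₂ s..R, u₂ s y)
        - heatK (t - s) (x - z₂ s)) s := by
  obtain ⟨V, hV, hsub, hu⟩ := h.u_smooth
  obtain ⟨uₜ, uₓ, uₓₓ, hcₜ, hcₓ, hcₓₓ, hd⟩ := exists_continuousOn_partials hV hu
  have hmem : ∀ y ∈ Icc (z₂ s) R, (s, y) ∈ V := fun y hy =>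
    hsub (h.mem_closure hs.le hy.1)
  have hσ : 0 < t - s := sub_pos.2 hst
  have hW : IsOpen (V ∩ {q : ℝ × ℝ | q.1 < t}) :=
    hV.inter (isOpen_lt continuous_fst continuous_const)
  have hK : ∀ f : ℝ × ℝ → ℝ, Continuous f → ContinuousOn
      (fun q : ℝ × ℝ => f q / (t - q.1) * heatK (t - q.1) (f q)) {q | q.1 < t} := by
    intro f hf
    refine ContinuousOn.mul (ContinuousOn.div hf.continuousOn (by fun_prop)
      fun q hq => (sub_pos.2 hq).ne') ?_
    exact continuousOn_heatK.comp (f := fun q : ℝ × ℝ => (t - q.1, f q)) (by fun_prop)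
      fun q (hq : q.1 < t) => show 0 < t - q.1 from sub_pos.2 hq
  have hz : HasDerivAt z₂ (deriv z₂ s) s :=
    ((h.z_contDiff.differentiableOn (by norm_num)).differentiableAt
      (Ioi_mem_nhds hs)).hasDerivAt
  have hmain := hasDerivAt_integral_moving_lower
    (g := fun s y => heatMass t x R s y * u₂ s y)
    (g' := fun s y => (1 / 2 * ((x - y) / (t - s) * heatK (t - s) (x - y))
        - 1 / 2 * ((x - R) / (t - s) * heatK (t - s) (x - R))) * u₂ s y
      + heatMass t x R s y * uₜ s y)
    hW hz hR.le (fun y hy => ⟨hmem y hy, hst⟩)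
    (((continuousOn_heatMass t x R).mono inter_subset_right).mul
      (hu.continuousOn.mono inter_subset_left))
    (((((hK (fun q => x - q.2) (by fun_prop)).mono inter_subset_right).const_mul _).sub
      (((hK (fun q => x - R) (by fun_prop)).mono inter_subset_right).const_mul _)).mul
      (hu.continuousOn.mono inter_subset_left) |>.add
      (((continuousOn_heatMass t x R).mono inter_subset_right).mul (hcₜ.mono inter_subset_left)))
    (fun q hq => (hasDerivAt_heatMass_left t x R hq.2 q.2).mul (hd q hq.1).1)
  refine hmain.congr_deriv ?_
  have hslice : ∀ {k : ℝ → ℝ → ℝ}, ContinuousOn (fun q : ℝ × ℝ => k q.1 q.2) V →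
      ContinuousOn (k s) (uIcc (z₂ s) R) := by
    intro k hk
    rw [uIcc_of_le hR.le]
    exact hk.comp (f := fun y => (s, y)) (by fun_prop) hmem
  have hKs : ContinuousOn (fun y => (x - y) / (t - s) * heatK (t - s) (x - y))
      (uIcc (z₂ s) R) :=
    (hK (fun q => x - q.2) (by fun_prop)).comp (f := fun y => (s, y)) (by fun_prop)
      fun y _ => hst
  have hPs : ContinuousOn (heatMass t x R s) (uIcc (z₂ s) R) := fun y _ =>
    (hasDerivAt_heatMass_right t x R hst y).continuousAt.continuousWithinAt
  have hint₁ : IntervalIntegrable (fun y => heatMass t x R s y * uₓₓ s y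
      + (x - y) / (t - s) * heatK (t - s) (x - y) * u₂ s y) volume (z₂ s) R :=
    ((hPs.mul (hslice hcₓₓ)).add (hKs.mul (hslice hu.continuousOn))).intervalIntegrable
  have hint₂ : IntervalIntegrable (u₂ s) volume (z₂ s) R :=
    (hslice hu.continuousOn).intervalIntegrable
  have hibp : ∫ y in z₂ s..R, (heatMass t x R s y * uₓₓ s y
      + (x - y) / (t - s) * heatK (t - s) (x - y) * u₂ s y)
      = (heatMass t x R s R * uₓ s R + heatK (t - s) (x - R) * u₂ s R)
        - (heatMass t x R s (z₂ s) * uₓ s (z₂ s) + heatK (t - s) (x - z₂ s) * u₂ s (z₂ s)) := by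
    refine intervalIntegral.integral_eq_sub_of_hasDerivAt
      (f := fun y => heatMass t x R s y * uₓ s y + heatK (t - s) (x - y) * u₂ s y)
      (fun y hy => ?_) hint₁
    rw [uIcc_of_le hR.le] at hy
    obtain ⟨-, h1, h2⟩ := hd _ (hmem y hy)
    refine (((hasDerivAt_heatMass_right t x R hst y).mul h2).add
      ((hasDerivAt_heatK_sub hσ x y).mul h1)).congr_deriv ?_
    ring
  have hheat : ∀ y ∈ Ioc (z₂ s) R, uₜ s y = 1 / 2 * uₓₓ s y := by
    intro y hy
    have hyV := hmem y ⟨hy.1.le, hy.2⟩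
    obtain ⟨h1, -, h3⟩ := hd _ hyV
    have h4 := h.heatEq s hs y hy.1
    rw [h1.deriv] at h4
    have h5 : deriv (u₂ s) =ᶠ[𝓝 y] uₓ s := by
      have hVy : ∀ᶠ y' in 𝓝 y, (s, y') ∈ V :=
        (Continuous.prodMk_right s).continuousAt.eventually (hV.mem_nhds hyV)
      filter_upwards [hVy] with y' hy'
      exact (hd _ hy').2.1.deriv
    rw [h5.deriv_eq, h3.deriv] at h4
    exact h4
  have hbc := h.stefanBC s hs
  rw [(hd _ (hmem _ ⟨le_rfl, hR.le⟩)).2.1.deriv] at hbc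
  have hsplit : ∫ y in z₂ s..R, ((1 / 2 * ((x - y) / (t - s) * heatK (t - s) (x - y))
        - 1 / 2 * ((x - R) / (t - s) * heatK (t - s) (x - R))) * u₂ s y
      + heatMass t x R s y * uₜ s y)
      = 1 / 2 * (∫ y in z₂ s..R, (heatMass t x R s y * uₓₓ s y
        + (x - y) / (t - s) * heatK (t - s) (x - y) * u₂ s y))
      - 1 / 2 * ((x - R) / (t - s) * heatK (t - s) (x - R)) * ∫ y in z₂ s..R, u₂ s y := by
    rw [← intervalIntegral.integral_const_mul, ← intervalIntegral.integral_const_mul,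
      ← intervalIntegral.integral_sub (hint₁.const_mul _) (hint₂.const_mul _)]
    refine intervalIntegral.integral_congr_ae (ae_of_all _ fun y hy => ?_)
    rw [uIoc_of_le hR.le] at hy
    rw [hheat y hy]
    ring
  rw [hsplit, hibp, heatMass_self, h.bdryVal s hs.le]
  linear_combination (-heatMass t x R s (z₂ s)) * hbc

/-- Flux through the truncation level `R` in the evolution of the heat-weighted mass. -/
noncomputable def truncFlux (z₂ : ℝ → ℝ) (u₂ : ℝ → ℝ → ℝ) (t x R s : ℝ) : ℝ :=
  1 / 2 * (heatK (t - s) (x - R) * u₂ s R)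
    - 1 / 2 * ((x - R) / (t - s) * heatK (t - s) (x - R)) * ∫ y in z₂ s..R, u₂ s y

lemma abs_truncFlux_le (h : StefanSolution z₂ u₂) {M : ℝ}
    (hM : ∀ q ∈ closure (stefanDomain z₂), |u₂ q.1 q.2| ≤ M) {t x R s : ℝ} (hs : 0 < s)
    (hst : s < t) (hR : z₂ s < R) (hx : x < R) :
    |truncFlux z₂ u₂ t x R s|
      ≤ 4 * M * (t * √t) / (R - x) ^ 4 + 4 * M * √t * R / (R - x) ^ 3 := by
  have ht : 0 < t := hs.trans hst
  have hts : t - s ≤ t := by linarith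
  have hσ : 0 < t - s := sub_pos.2 hst
  have hw : 0 < R - x := sub_pos.2 hx
  have hq : 0 < √(t - s) := Real.sqrt_pos.2 hσ
  have hq' : √(t - s) ≤ √t := Real.sqrt_le_sqrt hts
  have hM0 : 0 ≤ M := (abs_nonneg _).trans (hM (s, R) (h.mem_closure hs.le hR.le))
  have hR0 : 0 ≤ R := (h.z_nonneg hs.le).trans hR.le
  have hk : heatK (t - s) (R - x) ≤ 8 * ((t - s) * √(t - s)) / (R - x) ^ 4 := by
    refine (heatK_le_div_pow hσ hw).trans_eq ?_
    have h2 : (t - s) ^ 2 = (t - s) * (√(t - s) * √(t - s)) := by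
      rw [Real.mul_self_sqrt hσ.le, sq]
    rw [h2]
    field_simp
  have hk0 := heatK_nonneg (t - s) (R - x)
  have hU : |∫ y in z₂ s..R, u₂ s y| ≤ M * R := by
    refine (intervalIntegral.norm_integral_le_of_norm_le_const (f := u₂ s) (C := M)
      fun y hy => ?_).trans ?_
    · rw [uIoc_of_le hR.le] at hy
      exact hM (s, y) (h.mem_closure hs.le hy.1.le)
    · rw [abs_of_pos (sub_pos.2 hR)]
      gcongr
      linarith [h.z_nonneg hs.le]
  have hu : |u₂ s R| ≤ M := hM (s, R) (h.mem_closure hs.le hR.le)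
  have hflux : (R - x) / (t - s) * heatK (t - s) (R - x) ≤ 8 * √t / (R - x) ^ 3 := by
    calc _ ≤ (R - x) / (t - s) * (8 * ((t - s) * √(t - s)) / (R - x) ^ 4) := by gcongr
      _ = 8 * √(t - s) / (R - x) ^ 3 := by field_simp
      _ ≤ _ := by gcongr
  have hk' : heatK (t - s) (R - x) ≤ 8 * (t * √t) / (R - x) ^ 4 := by
    refine hk.trans ?_
    gcongr
  have hneg : heatK (t - s) (x - R) = heatK (t - s) (R - x) := by rw [← heatK_neg, neg_sub]
  have heq : truncFlux z₂ u₂ t x R s = 1 / 2 * (heatK (t - s) (R - x) * u₂ s R)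
      + 1 / 2 * ((R - x) / (t - s) * heatK (t - s) (R - x)) * ∫ y in z₂ s..R, u₂ s y := by
    rw [truncFlux, hneg]
    ring
  have hfl0 : 0 ≤ (R - x) / (t - s) * heatK (t - s) (R - x) := by positivity
  rw [heq]
  calc _ ≤ |1 / 2 * (heatK (t - s) (R - x) * u₂ s R)|
        + |1 / 2 * ((R - x) / (t - s) * heatK (t - s) (R - x)) * ∫ y in z₂ s..R, u₂ s y| :=
        abs_add_le _ _
    _ = 1 / 2 * (heatK (t - s) (R - x) * |u₂ s R|)
        + 1 / 2 * ((R - x) / (t - s) * heatK (t - s) (R - x)) * |∫ y in z₂ s..R, u₂ s y| := by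
        rw [abs_mul, abs_mul, abs_mul, abs_mul (1 / 2), abs_of_nonneg hk0, abs_of_nonneg hfl0,
          abs_of_pos (by norm_num : (0 : ℝ) < 1 / 2)]
    _ ≤ 1 / 2 * (8 * (t * √t) / (R - x) ^ 4 * M)
        + 1 / 2 * (8 * √t / (R - x) ^ 3) * (M * R) := by gcongr
    _ = _ := by ring

lemma intervalIntegrable_heatK_boundary (h : StefanSolution z₂ u₂) {t : ℝ} (ht : 0 < t) (x : ℝ) :
    IntervalIntegrable (fun s => heatK (t - s) (x - z₂ s)) volume 0 t := by
  have hb : IntervalIntegrable (fun s : ℝ => (t - s) ^ (-(1 / 2) : ℝ)) volume 0 t := by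
    simpa using ((intervalIntegral.intervalIntegrable_rpow' (a := 0) (b := t)
      (r := -(1 / 2)) (by norm_num)).comp_sub_left t).symm
  refine hb.mono_fun' ?_ ?_
  · rw [uIoc_of_le ht.le, ← restrict_Ioo_eq_restrict_Ioc]
    refine ContinuousOn.aestronglyMeasurable ?_ measurableSet_Ioo
    refine continuousOn_heatK.comp (f := fun s => (t - s, x - z₂ s)) ?_
      fun s hs => show 0 < t - s from sub_pos.2 hs.2
    exact ContinuousOn.prodMk (by fun_prop)
      (continuousOn_const.sub (h.z_cont.mono fun s hs => hs.1.le))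
  · rw [uIoc_of_le ht.le, ← restrict_Ioo_eq_restrict_Ioc]
    refine (ae_restrict_iff' measurableSet_Ioo).2 (ae_of_all _ fun s hs => ?_)
    have hσ : 0 < t - s := sub_pos.2 hs.2
    dsimp only
    rw [Real.norm_eq_abs, abs_of_nonneg (heatK_nonneg _ _), Real.rpow_neg hσ.le,
      ← Real.sqrt_eq_rpow]
    exact heatK_le_inv_sqrt hσ _

lemma integral_heatMass_zero (h : StefanSolution z₂ u₂) {t x R : ℝ} (ht : 0 < t) (hR : 0 ≤ R) :
    ∫ y in z₂ 0..R, heatMass t x R 0 y * u₂ 0 y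
      = ∫ y in (0 : ℝ)..R, heatK t (x - y) * distFn z₂ u₂ 0 y := by
  have hc : ∀ y, 0 ≤ y → ContinuousAt (u₂ 0) y := fun y hy =>
    h.continuousAt_slice le_rfl (by rwa [h.z_init])
  have hcon : ∀ y, 0 ≤ y → ContinuousOn (u₂ 0) (uIcc 0 y) := fun y hy v hv => by
    rw [uIcc_of_le hy] at hv
    exact (hc v hv.1).continuousWithinAt
  obtain ⟨V, hV, hsub, hu⟩ := h.u_smooth
  have hV0 : IsOpen ((fun y : ℝ => ((0 : ℝ), y)) ⁻¹' V) := hV.preimage (by fun_prop)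
  have hcV : ContinuousOn (u₂ 0) ((fun y : ℝ => ((0 : ℝ), y)) ⁻¹' V) :=
    hu.continuousOn.comp (f := fun y : ℝ => ((0 : ℝ), y)) (by fun_prop) fun y hy => hy
  have hU : ∀ y ∈ uIcc 0 R, HasDerivAt (fun v => ∫ w in (0 : ℝ)..v, u₂ 0 w) (u₂ 0 y) y := by
    intro y hy
    rw [uIcc_of_le hR] at hy
    exact intervalIntegral.integral_hasDerivAt_right (hcon y hy.1).intervalIntegrable
      (hcV.stronglyMeasurableAtFilter hV0 y
        (hsub (h.mem_closure le_rfl (by rw [h.z_init]; exact hy.1)))) (hc y hy.1)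
  have hK : ContinuousOn (fun y => -heatK (t - 0) (x - y)) (uIcc 0 R) := fun y _ =>
    (hasDerivAt_heatK_sub (by simpa using ht) x y).continuousAt.neg.continuousWithinAt
  rw [h.z_init, intervalIntegral.integral_mul_deriv_eq_deriv_mul
    (fun y _ => hasDerivAt_heatMass_right t x R ht y) hU hK.intervalIntegrable
    (hcon R hR).intervalIntegrable, heatMass_self, intervalIntegral.integral_same, zero_mul,
    mul_zero, sub_zero, zero_sub, ← intervalIntegral.integral_neg]
  refine intervalIntegral.integral_congr fun y hy => ?_
  rw [uIcc_of_le hR] at hy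
  simp [distFn, h.z_init, hy.1]

lemma integral_indicator_eq_distFn (h : StefanSolution z₂ u₂) {t x R : ℝ} (ht : 0 ≤ t)
    (hz : z₂ t ≤ R) (hx : x ≤ R) :
    ∫ y in z₂ t..R, (if y < x then 1 else 0) * u₂ t y = distFn z₂ u₂ t x := by
  unfold distFn
  have hright : ∀ a, x ≤ a → a ≤ R → ∫ y in a..R, (if y < x then 1 else 0) * u₂ t y = 0 := by
    intro a ha haR
    refine intervalIntegral.integral_zero_ae (ae_of_all _ fun y hy => ?_)
    rw [uIoc_of_le haR] at hy
    rw [if_neg (not_lt.2 (ha.trans hy.1.le)), zero_mul]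
  split_ifs with hzx
  · have hleft : ∀ᵐ y : ℝ, y ∈ uIoc (z₂ t) x → (if y < x then 1 else 0) * u₂ t y = u₂ t y := by
      filter_upwards [Measure.ae_ne volume x] with y hne hy
      rw [uIoc_of_le hzx] at hy
      rw [if_pos (lt_of_le_of_ne hy.2 hne), one_mul]
    have hi : IntervalIntegrable (u₂ t) volume (z₂ t) x :=
      ((h.continuousOn_slice ht).mono (by
        rw [uIcc_of_le hzx]; exact Icc_subset_Ici_self)).intervalIntegrable
    have hi₁ : IntervalIntegrable (fun y => (if y < x then 1 else 0) * u₂ t y) volume (z₂ t) x :=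
      hi.congr_ae ((ae_restrict_iff' measurableSet_uIoc).2
        (hleft.mono fun y hy hm => (hy hm).symm))
    have hi₂ : IntervalIntegrable (fun y => (if y < x then 1 else 0) * u₂ t y) volume x R := by
      refine (IntervalIntegrable.zero (μ := volume) (a := x) (b := R)).congr_ae
        ((ae_restrict_iff' measurableSet_uIoc).2 (ae_of_all _ fun y hy => ?_))
      rw [uIoc_of_le hx] at hy
      simp [not_lt.2 hy.1.le]
    rw [← intervalIntegral.integral_add_adjacent_intervals hi₁ hi₂, hright x le_rfl hx, add_zero]
    exact intervalIntegral.integral_congr_ae hleft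
  · exact hright _ (not_le.1 hzx).le hz

lemma intervalIntegrable_truncFlux (h : StefanSolution z₂ u₂) {t x R : ℝ} (ht : 0 < t)
    (hz : z₂ t < R) (hx : x < R) :
    IntervalIntegrable (truncFlux z₂ u₂ t x R) volume 0 t := by
  obtain ⟨M, hM⟩ := h.u_bdd
  have hzR : ∀ s ∈ Ioo 0 t, z₂ s < R := fun s hs =>
    (h.z_mono hs.1.le ht.le hs.2.le).trans_lt hz
  refine IntervalIntegrable.mono_fun' (g := fun _ =>
    4 * M * (t * √t) / (R - x) ^ 4 + 4 * M * √t * R / (R - x) ^ 3) (by simp) ?_ ?_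
  · have hm := (measurable_deriv (fun s => ∫ y in z₂ s..R, heatMass t x R s y * u₂ s y)
      ).aestronglyMeasurable (μ := volume.restrict (uIoc 0 t)) |>.add
        (h.intervalIntegrable_heatK_boundary ht x).aestronglyMeasurable_restrict_uIoc
    refine hm.congr ?_
    rw [uIoc_of_le ht.le, ← restrict_Ioo_eq_restrict_Ioc]
    refine (ae_restrict_iff' measurableSet_Ioo).2 (ae_of_all _ fun s hs => ?_)
    simp only [Pi.add_apply]
    rw [(h.hasDerivAt_integral_heatMass hs.1 hs.2 (hzR s hs)).deriv, truncFlux]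
    ring
  · rw [uIoc_of_le ht.le, ← restrict_Ioo_eq_restrict_Ioc]
    exact (ae_restrict_iff' measurableSet_Ioo).2 (ae_of_all _ fun s hs =>
      h.abs_truncFlux_le hM hs.1 hs.2 (hzR s hs) hx)

/-- The integral identity with initial datum truncated at `R`, up to a flux term. -/
lemma distFn_eq_truncated (h : StefanSolution z₂ u₂) {t x R : ℝ} (ht : 0 < t)
    (hz : z₂ t < R) (hx : x < R) :
    distFn z₂ u₂ t x = (∫ y in (0 : ℝ)..R, heatK t (x - y) * distFn z₂ u₂ 0 y)
      - (∫ s in (0 : ℝ)..t, heatK (t - s) (x - z₂ s))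
      + ∫ s in (0 : ℝ)..t, truncFlux z₂ u₂ t x R s := by
  have hz0 : 0 < R := (h.z_nonneg ht.le).trans_lt hz
  have hzR : ∀ s ∈ Ioo 0 t, z₂ s < R := fun s hs =>
    (h.z_mono hs.1.le ht.le hs.2.le).trans_lt hz
  have hcont : ∀ s, s < t → Continuous (heatMass t x R s) := fun s hs =>
    continuous_iff_continuousAt.2 fun y => (hasDerivAt_heatMass_right t x R hs y).continuousAt
  have hstart : Tendsto (fun s => ∫ y in z₂ s..R, heatMass t x R s y * u₂ s y) (𝓝[>] 0)
      (𝓝 (∫ y in z₂ 0..R, heatMass t x R 0 y * u₂ 0 y)) := by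
    refine h.tendsto_integral_mul (c := x) le_rfl (by rwa [h.z_init])
      (nhdsWithin_mono _ Ioi_subset_Ici_self) ?_ (abs_heatMass_le t x R) fun y _ => ?_
    · filter_upwards [nhdsWithin_le_nhds (Iio_mem_nhds ht)] with s hs using hcont s hs
    · exact (hasDerivAt_heatMass_left t x R ht y).continuousAt.tendsto.mono_left
        nhdsWithin_le_nhds
  have hend : Tendsto (fun s => ∫ y in z₂ s..R, heatMass t x R s y * u₂ s y) (𝓝[<] t)
      (𝓝 (∫ y in z₂ t..R, (if y < x then 1 else 0) * u₂ t y)) := by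
    refine h.tendsto_integral_mul (c := x) ht.le hz ?_ ?_ (abs_heatMass_le t x R)
      fun y hy => tendsto_heatMass hx hy
    · rw [nhdsWithin_eq_nhds.2 (Ici_mem_nhds ht)]
      exact nhdsWithin_le_nhds
    · filter_upwards [self_mem_nhdsWithin] with s hs using hcont s hs
  have hi₁ := h.intervalIntegrable_truncFlux ht hz hx
  have hi₂ := h.intervalIntegrable_heatK_boundary ht x
  have key := intervalIntegral.integral_eq_sub_of_hasDerivAt_of_tendsto ht
    (f' := fun s => truncFlux z₂ u₂ t x R s - heatK (t - s) (x - z₂ s))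
    (fun s hs => h.hasDerivAt_integral_heatMass hs.1 hs.2 (hzR s hs)) (hi₁.sub hi₂) hstart hend
  rw [intervalIntegral.integral_sub hi₁ hi₂, h.integral_heatMass_zero ht hz0.le,
    h.integral_indicator_eq_distFn ht.le hz.le hx.le] at key
  linarith

lemma tendsto_integral_truncFlux (h : StefanSolution z₂ u₂) {t : ℝ} (ht : 0 < t) (x : ℝ) :
    Tendsto (fun R => ∫ s in (0 : ℝ)..t, truncFlux z₂ u₂ t x R s) atTop (𝓝 0) := by
  obtain ⟨M, hM⟩ := h.u_bdd
  have hv : Tendsto (fun R : ℝ => (R - x)⁻¹) atTop (𝓝 0) :=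
    tendsto_inv_atTop_zero.comp (tendsto_atTop_add_const_right _ (-x) tendsto_id)
  have hpoly : Continuous fun v : ℝ =>
      (4 * M * (t * √t) * v ^ 4 + 4 * M * √t * (v ^ 2 + x * v ^ 3)) * t := by fun_prop
  have hlim := (hpoly.tendsto 0).comp hv
  refine squeeze_zero_norm' ?_ (by simpa [Function.comp_def] using hlim)
  filter_upwards [eventually_gt_atTop x, eventually_gt_atTop (z₂ t)] with R hx hz
  have hw : R - x ≠ 0 := (sub_pos.2 hx).ne'
  have hbound : ‖∫ s in (0 : ℝ)..t, truncFlux z₂ u₂ t x R s‖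
      ≤ (4 * M * (t * √t) / (R - x) ^ 4 + 4 * M * √t * R / (R - x) ^ 3) * |t - 0| := by
    refine intervalIntegral.norm_integral_le_of_norm_le_const_ae ?_
    filter_upwards [Measure.ae_ne volume t] with s hne hs
    rw [uIoc_of_le ht.le] at hs
    exact h.abs_truncFlux_le hM hs.1 (lt_of_le_of_ne hs.2 hne)
      ((h.z_mono hs.1.le ht.le hs.2).trans_lt hz) hx
  refine hbound.trans_eq ?_
  rw [sub_zero, abs_of_pos ht]
  field_simp
  ring

lemma integrableOn_heatK_mul_distFn_zero (h : StefanSolution z₂ u₂) {t : ℝ} (ht : 0 < t) (x : ℝ) :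
    IntegrableOn (fun y => heatK t (x - y) * distFn z₂ u₂ 0 y) (Ioi 0) := by
  have hint := h.u_intSlice 0 le_rfl
  rw [h.z_init] at hint
  have hind : Integrable ((Ici 0).indicator (u₂ 0)) :=
    (integrable_indicator_iff measurableSet_Ici).2 hint
  have heq : ∀ y ∈ Ioi (0 : ℝ), distFn z₂ u₂ 0 y
      = ∫ w in (0 : ℝ)..y, (Ici 0).indicator (u₂ 0) w := by
    intro y hy
    rw [distFn, h.z_init, if_pos (le_of_lt hy)]
    refine intervalIntegral.integral_congr fun w hw => ?_
    rw [uIcc_of_le (le_of_lt hy)] at hw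
    rw [indicator_of_mem (show w ∈ Ici 0 from hw.1)]
  have hcont : Continuous fun y => ∫ w in (0 : ℝ)..y, (Ici 0).indicator (u₂ 0) w :=
    intervalIntegral.continuous_primitive (fun _ _ => hind.intervalIntegrable) 0
  have hK : IntegrableOn (fun y => heatK t (x - y)) (Ioi 0) :=
    ((integrable_heatK ht).comp_sub_left x).integrableOn
  have hmul : IntegrableOn (fun y => heatK t (x - y) *
      ∫ w in (0 : ℝ)..y, (Ici 0).indicator (u₂ 0) w) (Ioi 0) := by
    refine hK.mul_bdd (c := ∫ w, ‖(Ici 0).indicator (u₂ 0) w‖)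
      hcont.aestronglyMeasurable (ae_of_all _ fun y => ?_)
    exact intervalIntegral.norm_integral_le_integral_norm_uIoc.trans
      (setIntegral_le_integral hind.norm (ae_of_all _ fun _ => norm_nonneg _))
  refine hmul.congr_fun (fun y hy => ?_) measurableSet_Ioi
  simp only [heq y hy]

end StefanSolution

/-- Integral identity for the distribution function of a classical Stefan solution, valid
for all `t > 0` and all `x ∈ ℝ` (including `x < z₂(t)`):
`U₂(t,x) = ∫₀^∞ p(t,x-y) U₂(0,y) dy - ∫₀ᵗ p(t-s, x - z₂(s)) ds`. -/
theorem stefan_distribution_integral_identity (z₂ : ℝ → ℝ) (u₂ : ℝ → ℝ → ℝ)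
    (h : StefanSolution z₂ u₂) (t : ℝ) (ht : 0 < t) (x : ℝ) :
    distFn z₂ u₂ t x
      = (∫ y in Set.Ioi (0:ℝ), heatK t (x - y) * distFn z₂ u₂ 0 y)
        - ∫ s in (0:ℝ)..t, heatK (t - s) (x - z₂ s) := by
  have hA := intervalIntegral_tendsto_integral_Ioi 0
    (h.integrableOn_heatK_mul_distFn_zero ht x) tendsto_id
  have hlim := (hA.sub_const (∫ s in (0:ℝ)..t, heatK (t - s) (x - z₂ s))).add
    (h.tendsto_integral_truncFlux ht x)
  rw [add_zero] at hlim
  refine tendsto_nhds_unique (tendsto_const_nhds.congr' ?_) hlim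
  filter_upwards [eventually_gt_atTop x, eventually_gt_atTop (z₂ t)] with R hx hz
  exact h.distFn_eq_truncated ht hz hx
end

section
/- Stability of the perturbed Stefan integral equation: fix T < ∞ and bounded measurable functions f₁, f₂ : [0,T] × ℝ → ℝ. Suppose w₁, w₂ ∈ C([0,T]) satisfy, for i = 1,2 and every t ∈ (0,T], the equation ∫₀^∞ p(t, wᵢ(t) − y) U_{**}(y) dy = fᵢ(t, wᵢ(t)) + ∫₀ᵗ p(t−s, wᵢ(t) − wᵢ(s)) ds. Let L := sup{|w₁(t)|, |w₂(t)| : 0 ≤ t ≤ T} + 1, and let ε := Σ_{i=1,2} ( |wᵢ(0)| + ‖fᵢ‖_{L^∞([0,T]×ℝ)} + |wᵢ|′_{[0,T]} ). Then there exists a constant C₁ = C₁(T, L) < ∞ such that whenever ε ≤ 1/C₁ one has sup_{0 ≤ t ≤ T} (w₁(t) − w₂(t)) ≤ C₁ ε. -/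
open MeasureTheory Real Set

/-- The Gaussian tail `Φ̃(t,x) = ∫ₓ^∞ p(t,y) dy`. -/
noncomputable def gaussTail (t x : ℝ) : ℝ := ∫ y in Set.Ioi x, heatK t y

/-- The density `u₁(t,x) = -2∂ₓp(t,x) + 4Φ̃(t,x) = (2x/t)p(t,x) + 4Φ̃(t,x)`. -/
noncomputable def u1 (t x : ℝ) : ℝ := (2 * x / t) * heatK t x + 4 * gaussTail t x

/-- The profile `U_{**}(y) = ∫₀^y u₁(1/2, w) dw`. -/
noncomputable def Ustst (y : ℝ) : ℝ := ∫ w in (0:ℝ)..y, u1 (1 / 2) w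

/-- The nondecreasingness seminorm `|w|'_{[0,T]} = sup { w(t) - w(t') : 0 ≤ t ≤ t' ≤ T }`. -/
noncomputable def nondecSemi (w : ℝ → ℝ) (T : ℝ) : ℝ :=
  sSup {d : ℝ | ∃ t t' : ℝ, 0 ≤ t ∧ t ≤ t' ∧ t' ≤ T ∧ d = w t - w t'}

theorem heatK_eq_gaussianPDFReal {t : ℝ} (ht : 0 ≤ t) (x : ℝ) :
    heatK t x = ProbabilityTheory.gaussianPDFReal 0 t.toNNReal x := by
  simp [heatK, ProbabilityTheory.gaussianPDFReal, ht]

theorem integrable_heatK_s6 {t : ℝ} (ht : 0 ≤ t) : Integrable (heatK t) := by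
  rw [funext (heatK_eq_gaussianPDFReal ht)]
  exact ProbabilityTheory.integrable_gaussianPDFReal 0 _

theorem heatK_nonneg_s6 (t x : ℝ) : 0 ≤ heatK t x := by
  unfold heatK; positivity

theorem heatK_pos {t : ℝ} (ht : 0 < t) (x : ℝ) : 0 < heatK t x := by
  unfold heatK; positivity

theorem continuous_heatK (t : ℝ) : Continuous (heatK t) := by
  unfold heatK; fun_prop

theorem heatK_le_of_abs_le {t a b : ℝ} (ht : 0 ≤ t) (h : |b| ≤ |a|) : heatK t a ≤ heatK t b := by
  unfold heatK
  have := sq_le_sq.mpr h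
  gcongr

theorem heatK_le_heatK_zero {t : ℝ} (ht : 0 ≤ t) (a : ℝ) : heatK t a ≤ heatK t 0 :=
  heatK_le_of_abs_le ht (by simp)

theorem integrable_heatK_mul_abs {t : ℝ} (ht : 0 < t) :
    Integrable (fun z => heatK t z * |z|) := by
  have h := ((integrable_mul_exp_neg_mul_sq (b := (2 * t)⁻¹) (by positivity)).abs).const_mul
    (Real.sqrt (2 * Real.pi * t))⁻¹
  refine h.congr (.of_forall fun z => ?_)
  simp only [heatK, abs_mul, abs_of_pos (Real.exp_pos _)]
  rw [show -(2 * t)⁻¹ * z ^ 2 = -z ^ 2 / (2 * t) by ring]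
  ring

theorem gaussTail_antitone {t : ℝ} (ht : 0 ≤ t) : Antitone (gaussTail t) := fun _ _ h =>
  setIntegral_mono_set (integrable_heatK_s6 ht).integrableOn
    (.of_forall fun _ => heatK_nonneg_s6 t _) (Ioi_subset_Ioi h).eventuallyLE

theorem gaussTail_nonneg (t x : ℝ) : 0 ≤ gaussTail t x :=
  integral_nonneg fun _ => heatK_nonneg_s6 t _

theorem gaussTail_pos {t : ℝ} (ht : 0 < t) (x : ℝ) : 0 < gaussTail t x := by
  refine (setIntegral_pos_iff_support_of_nonneg_ae (.of_forall fun _ => heatK_nonneg_s6 t _)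
    (integrable_heatK_s6 ht.le).integrableOn).2 ?_
  have : Function.support (heatK t) = univ :=
    Set.eq_univ_of_forall fun y => (heatK_pos ht y).ne'
  simp [this]

theorem intervalIntegrable_u1 {t : ℝ} (ht : 0 ≤ t) (a b : ℝ) :
    IntervalIntegrable (u1 t) volume a b := by
  have h1 : Continuous fun x => 2 * x / t * heatK t x :=
    (by fun_prop : Continuous fun x : ℝ => 2 * x / t).mul (continuous_heatK t)
  exact (h1.intervalIntegrable a b).add
    ((gaussTail_antitone ht).intervalIntegrable.const_mul 4)

theorem four_mul_gaussTail_le_u1 {t x : ℝ} (ht : 0 ≤ t) (hx : 0 ≤ x) :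
    4 * gaussTail t x ≤ u1 t x := by
  have := heatK_nonneg_s6 t x
  have : 0 ≤ 2 * x / t * heatK t x := by positivity
  unfold u1; linarith

theorem exists_u1_half_le : ∃ K : ℝ, 0 ≤ K ∧ ∀ x, 0 ≤ x → u1 (1 / 2) x ≤ K := by
  refine ⟨4 * (Real.sqrt (2 * Real.pi * (1 / 2)))⁻¹ + 4 * gaussTail (1 / 2) 0, ?_, fun x hx => ?_⟩
  · have := gaussTail_nonneg (1 / 2) 0
    positivity
  · have h1 := gaussTail_antitone (t := 1 / 2) (by norm_num) hx
    have h2 : x * Real.exp (-x ^ 2) ≤ 1 := by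
      rw [Real.exp_neg, ← div_eq_mul_inv, div_le_one (Real.exp_pos _)]
      nlinarith [Real.add_one_le_exp (x ^ 2), sq_nonneg (x - 1)]
    have h3 : 2 * x / (1 / 2) * heatK (1 / 2) x =
        4 * (Real.sqrt (2 * Real.pi * (1 / 2)))⁻¹ * (x * Real.exp (-x ^ 2)) := by
      unfold heatK
      rw [show -x ^ 2 / (2 * (1 / 2)) = -x ^ 2 by ring]
      ring
    have h4 : 4 * (Real.sqrt (2 * Real.pi * (1 / 2)))⁻¹ * (x * Real.exp (-x ^ 2)) ≤
        4 * (Real.sqrt (2 * Real.pi * (1 / 2)))⁻¹ * 1 := by gcongr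
    unfold u1
    linarith

theorem Ustst_sub (a b : ℝ) : Ustst b - Ustst a = ∫ w in a..b, u1 (1 / 2) w :=
  intervalIntegral.integral_interval_sub_left
    (intervalIntegrable_u1 (by norm_num) _ _) (intervalIntegrable_u1 (by norm_num) _ _)

theorem mul_gaussTail_le_Ustst_sub {a b A : ℝ} (ha : 0 ≤ a) (hab : a ≤ b) (hb : b ≤ A) :
    4 * gaussTail (1 / 2) A * (b - a) ≤ Ustst b - Ustst a := by
  rw [Ustst_sub]
  have h := intervalIntegral.integral_mono_on hab (f := fun _ => 4 * gaussTail (1 / 2) A)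
    intervalIntegrable_const (intervalIntegrable_u1 (t := 1 / 2) (by norm_num) a b)
    (fun x hx => (mul_le_mul_of_nonneg_left
      (gaussTail_antitone (by norm_num) (hx.2.trans hb)) (by norm_num)).trans
      (four_mul_gaussTail_le_u1 (by norm_num) (ha.trans hx.1)))
  rw [intervalIntegral.integral_const, smul_eq_mul] at h
  linarith

theorem Ustst_monotoneOn : MonotoneOn Ustst (Ici 0) := fun a ha b _ hab => by
  have h := mul_gaussTail_le_Ustst_sub ha hab le_rfl
  have := mul_nonneg (mul_nonneg zero_le_four (gaussTail_nonneg (1 / 2) b)) (sub_nonneg.2 hab)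
  linarith

theorem Ustst_zero : Ustst 0 = 0 := by simp [Ustst]

theorem exists_Ustst_le : ∃ K : ℝ, 0 ≤ K ∧ ∀ y, 0 ≤ y → Ustst y ≤ K * y := by
  obtain ⟨K, hK, h⟩ := exists_u1_half_le
  refine ⟨K, hK, fun y hy => ?_⟩
  have := intervalIntegral.integral_mono_on hy
    (intervalIntegrable_u1 (t := 1 / 2) (by norm_num) 0 y)
    (g := fun _ => K) intervalIntegrable_const (fun x hx => h x hx.1)
  rw [intervalIntegral.integral_const, smul_eq_mul] at this
  unfold Ustst; linarith

theorem monotone_Ustst_max : Monotone fun y => Ustst (max y 0) := fun _ _ h =>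
  Ustst_monotoneOn (mem_Ici.2 (le_max_right _ _)) (mem_Ici.2 (le_max_right _ _))
    (max_le_max_right 0 h)

theorem Ustst_max_nonneg (y : ℝ) : 0 ≤ Ustst (max y 0) :=
  Ustst_zero.symm.trans_le
    (Ustst_monotoneOn self_mem_Ici (mem_Ici.2 (le_max_right _ _)) (le_max_right _ _))

theorem integral_heatK_mul_Ustst (t x : ℝ) :
    ∫ y in Ioi (0 : ℝ), heatK t (x - y) * Ustst y =
      ∫ z, heatK t z * Ustst (max (x - z) 0) := by
  rw [← integral_sub_left_eq_self _ volume x, ← integral_indicator measurableSet_Ioi]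
  congr 1 with y
  by_cases hy : 0 < y
  · simp [indicator, hy, max_eq_left hy.le]
  · simp [indicator, hy, max_eq_right (not_lt.1 hy), Ustst_zero]

theorem integrable_heatK_mul_Ustst_max {t : ℝ} (ht : 0 < t) (x : ℝ) :
    Integrable fun z => heatK t z * Ustst (max (x - z) 0) := by
  obtain ⟨K, hK, hU⟩ := exists_Ustst_le
  refine Integrable.mono'
    (((integrable_heatK_s6 ht.le).mul_const (K * |x|)).add
      ((integrable_heatK_mul_abs ht).mul_const K))
    ((continuous_heatK t).measurable.mul (monotone_Ustst_max.measurable.comp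
      (measurable_const.sub measurable_id))).aestronglyMeasurable
    (.of_forall fun z => ?_)
  have h1 : Ustst (max (x - z) 0) ≤ K * (|x| + |z|) := by
    refine (hU _ (le_max_right _ _)).trans
      (mul_le_mul_of_nonneg_left (max_le ?_ (by positivity)) hK)
    linarith [le_abs_self x, neg_abs_le z]
  have h0 := heatK_nonneg_s6 t z
  rw [Real.norm_of_nonneg (mul_nonneg h0 (Ustst_max_nonneg _))]
  calc heatK t z * Ustst (max (x - z) 0) ≤ heatK t z * (K * (|x| + |z|)) := by gcongr
    _ = _ := by simp only [Pi.add_apply]; ring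

/-- The heat flow of the profile `Ustst` grows at least linearly across a gap `x < x + δ` whose
upper half lies in the right half-line. -/
theorem le_integral_heatK_mul_Ustst_sub {t x δ A : ℝ} (ht : 0 < t) (hδ : 0 ≤ δ)
    (hx : -(δ / 2) ≤ x) (hA : x + δ + Real.sqrt t ≤ A) :
    2 * gaussTail (1 / 2) A * ((Real.sqrt (2 * Real.pi))⁻¹ * Real.exp (-(1 / 2))) * δ ≤
      (∫ y in Ioi (0 : ℝ), heatK t (x + δ - y) * Ustst y) -
        ∫ y in Ioi (0 : ℝ), heatK t (x - y) * Ustst y := by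
  have hi := integrable_heatK_mul_Ustst_max ht
  rw [integral_heatK_mul_Ustst, integral_heatK_mul_Ustst, ← integral_sub (hi _) (hi _)]
  set c : ℝ := ((Real.sqrt (2 * Real.pi * t))⁻¹ * Real.exp (-(1 / 2))) *
    (4 * gaussTail (1 / 2) A * (δ / 2)) with hc
  have hst : 0 < Real.sqrt t := Real.sqrt_pos.2 ht
  have hconst : ∫ _ in Icc (-Real.sqrt t) 0, c = 2 * gaussTail (1 / 2) A *
      ((Real.sqrt (2 * Real.pi))⁻¹ * Real.exp (-(1 / 2))) * δ := by
    rw [setIntegral_const, Real.volume_real_Icc_of_le (by linarith), smul_eq_mul, hc,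
      Real.sqrt_mul (by positivity)]
    field_simp
    ring
  rw [← hconst]
  have hint := (hi (x + δ)).sub (hi x)
  refine (setIntegral_mono_on (integrableOn_const (by simp)) hint.integrableOn
    measurableSet_Icc fun z hz => ?_).trans
    (setIntegral_le_integral hint (.of_forall fun z => ?_))
  · have hG := gaussTail_nonneg (1 / 2) A
    have h1 : (Real.sqrt (2 * Real.pi * t))⁻¹ * Real.exp (-(1 / 2)) ≤ heatK t z := by
      unfold heatK
      gcongr
      rw [le_div_iff₀ (by positivity)]
      nlinarith [Real.sq_sqrt ht.le, hz.1, hz.2]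
    have h2 := mul_gaussTail_le_Ustst_sub (a := x + δ / 2 - z) (b := x + δ - z) (A := A)
      (by linarith [hz.2]) (by linarith) (by linarith [hz.1])
    have h3 : Ustst (max (x - z) 0) ≤ Ustst (x + δ / 2 - z) :=
      Ustst_monotoneOn (mem_Ici.2 (le_max_right _ _)) (show (0 : ℝ) ≤ _ by linarith [hz.2])
        (max_le (by linarith) (by linarith [hz.2]))
    have h4 : max (x + δ - z) 0 = x + δ - z := max_eq_left (by linarith [hz.2])
    simp only [Pi.sub_apply]
    rw [h4, ← mul_sub, hc]
    refine mul_le_mul h1 ?_ (by positivity) (heatK_nonneg_s6 t z)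
    linarith [show 4 * gaussTail (1 / 2) A * (δ / 2) =
      4 * gaussTail (1 / 2) A * (x + δ - z - (x + δ / 2 - z)) by ring]
  · simp only [Pi.sub_apply, Pi.zero_apply]
    rw [← mul_sub]
    exact mul_nonneg (heatK_nonneg_s6 t z) (sub_nonneg.2 (monotone_Ustst_max (by linarith)))

theorem heatK_zero_sub_le {r e : ℝ} (hr : 0 < r) (he : 0 < e) :
    heatK r 0 - heatK r e ≤ 4 * e ^ 2 / (Real.sqrt r * (Real.sqrt r + e) ^ 2) := by
  have hs : 0 < Real.sqrt r := Real.sqrt_pos.2 hr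
  have h1 : (Real.sqrt (2 * Real.pi * r))⁻¹ ≤ (Real.sqrt r)⁻¹ := by
    gcongr
    nlinarith [Real.pi_gt_three]
  have h2 : 1 - Real.exp (-e ^ 2 / (2 * r)) ≤ 4 * e ^ 2 / (Real.sqrt r + e) ^ 2 := by
    rcases le_total (Real.sqrt r) e with h | h
    · have : 1 ≤ 4 * e ^ 2 / (Real.sqrt r + e) ^ 2 := by
        rw [le_div_iff₀ (by positivity)]; nlinarith
      linarith [Real.exp_pos (-e ^ 2 / (2 * r))]
    · have h3 := Real.add_one_le_exp (-e ^ 2 / (2 * r))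
      have h4 : e ^ 2 / (2 * r) ≤ 4 * e ^ 2 / (Real.sqrt r + e) ^ 2 := by
        rw [div_le_div_iff₀ (by positivity) (by positivity)]
        have : (Real.sqrt r + e) ^ 2 ≤ 8 * r := by nlinarith [Real.sq_sqrt hr.le]
        nlinarith [mul_le_mul_of_nonneg_left this (sq_nonneg e)]
      rw [neg_div] at h3 ⊢
      linarith
  have h0 : 0 ≤ 1 - Real.exp (-e ^ 2 / (2 * r)) :=
    sub_nonneg.2 (Real.exp_le_one_iff.2
      (div_nonpos_of_nonpos_of_nonneg (by nlinarith) (by linarith)))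
  calc heatK r 0 - heatK r e
      = (Real.sqrt (2 * Real.pi * r))⁻¹ * (1 - Real.exp (-e ^ 2 / (2 * r))) := by
        simp [heatK]; ring
    _ ≤ (Real.sqrt r)⁻¹ * (4 * e ^ 2 / (Real.sqrt r + e) ^ 2) := by gcongr
    _ = _ := by field_simp

theorem heatK_zero_eq (r : ℝ) : heatK r 0 = (Real.sqrt (2 * Real.pi))⁻¹ * (Real.sqrt r)⁻¹ := by
  simp [heatK, Real.sqrt_mul, Real.pi_nonneg]
  ring

theorem intervalIntegrable_heatK_zero {t : ℝ} (ht : 0 ≤ t) :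
    IntervalIntegrable (fun r => heatK r 0) volume 0 t := by
  have h := (intervalIntegral.intervalIntegrable_rpow' (a := 0) (b := t) (r := -(1 / 2))
    (by norm_num)).const_mul (Real.sqrt (2 * Real.pi))⁻¹
  refine h.congr fun r hr => ?_
  rw [uIoc_of_le ht] at hr
  simp only [heatK_zero_eq, Real.sqrt_eq_rpow r, Real.rpow_neg hr.1.le]

/-- Integrability in time of the heat kernel along a path that is continuous up to time `t`. -/
theorem intervalIntegrable_heatK_path {t : ℝ} (ht : 0 ≤ t) {g : ℝ → ℝ}
    (hg : ContinuousOn g (Icc 0 t)) :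
    IntervalIntegrable (fun s => heatK (t - s) (g s)) volume 0 t := by
  have h0 : IntervalIntegrable (fun s => heatK (t - s) 0) volume 0 t := by
    simpa using ((intervalIntegrable_heatK_zero ht).comp_sub_left t).symm
  rw [intervalIntegrable_iff_integrableOn_Ioo_of_le ht] at h0 ⊢
  refine Integrable.mono' h0 (ContinuousOn.aestronglyMeasurable ?_ measurableSet_Ioo)
    ((ae_restrict_iff' measurableSet_Ioo).2 (.of_forall fun s hs => ?_))
  · unfold heatK
    have hg' := hg.mono Ioo_subset_Icc_self
    have h2 : ContinuousOn (fun s => t - s) (Ioo 0 t) := by fun_prop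
    refine ContinuousOn.mul (ContinuousOn.inv₀ (by fun_prop) fun s hs => ?_)
      (Real.continuous_exp.comp_continuousOn (ContinuousOn.div (by fun_prop) (by fun_prop)
        fun s hs => ?_))
    · have : 0 < t - s := sub_pos.2 hs.2
      positivity
    · have : 0 < t - s := sub_pos.2 hs.2
      positivity
  · rw [Real.norm_of_nonneg (heatK_nonneg_s6 _ _)]
    exact heatK_le_heatK_zero (sub_nonneg.2 hs.2.le) _

theorem integral_heatK_zero_sub_le {t e : ℝ} (ht : 0 ≤ t) (he : 0 < e) :
    ∫ s in (0 : ℝ)..t, (heatK (t - s) 0 - heatK (t - s) e) ≤ 8 * e := by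
  rw [intervalIntegral.integral_comp_sub_left (fun r => heatK r 0 - heatK r e) t]
  simp only [sub_self, sub_zero]
  have hi : IntervalIntegrable (fun r => heatK r 0 - heatK r e) volume 0 t := by
    have h := (intervalIntegrable_heatK_path ht (continuousOn_const (c := e))).comp_sub_left t
    simp only [sub_sub_cancel, sub_zero, sub_self] at h
    exact (intervalIntegrable_heatK_zero ht).sub h.symm
  have hpos : ∀ r : ℝ, 0 < Real.sqrt r + e := fun r => by positivity
  have hF := intervalIntegral.integral_le_sub_of_hasDeriv_right_of_le
    (g := fun r => 8 * e * Real.sqrt r / (Real.sqrt r + e))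
    (g' := fun r => 4 * e ^ 2 / (Real.sqrt r * (Real.sqrt r + e) ^ 2))
    (φ := fun r => heatK r 0 - heatK r e) ht
    (Continuous.continuousOn (Continuous.div (by fun_prop) (by fun_prop) fun r => (hpos r).ne'))
    (fun r hr => ?_)
    ((intervalIntegrable_iff_integrableOn_Icc_of_le ht).1 hi)
    (fun r hr => heatK_zero_sub_le hr.1 he)
  · refine hF.trans ?_
    simp only [Real.sqrt_zero, mul_zero, zero_div, sub_zero]
    rw [div_le_iff₀ (hpos t)]
    nlinarith [Real.sqrt_nonneg t]
  · have hs : 0 < Real.sqrt r := Real.sqrt_pos.2 hr.1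
    have hd := Real.hasDerivAt_sqrt hr.1.ne'
    have := (hd.const_mul (8 * e)).div (hd.add_const e) (hpos r).ne'
    refine (this.congr_deriv ?_).hasDerivWithinAt
    have := hpos r
    field_simp
    ring

theorem heatK_le_heatK_add {r a b e : ℝ} (hr : 0 ≤ r) (hab : b ≤ a) (hb : -e ≤ b) :
    heatK r a ≤ heatK r b + (heatK r 0 - heatK r e) := by
  rcases le_total 0 b with h | h
  · have h1 : heatK r a ≤ heatK r b :=
      heatK_le_of_abs_le hr (by rwa [abs_of_nonneg h, abs_of_nonneg (h.trans hab)])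
    linarith [heatK_le_heatK_zero hr e]
  · have h1 : heatK r e ≤ heatK r b :=
      heatK_le_of_abs_le hr (by rw [abs_of_nonpos h]; linarith [le_abs_self e])
    linarith [heatK_le_heatK_zero hr a]

/-- Comparison of the local-time terms of two paths, when the increments of the first dominate
those of the second, which are almost nonnegative. -/
theorem integral_heatK_path_le {t e : ℝ} (ht : 0 ≤ t) (he : 0 < e) {g h : ℝ → ℝ}
    (hg : ContinuousOn g (Icc 0 t)) (hh : ContinuousOn h (Icc 0 t))
    (hgh : ∀ s ∈ Icc 0 t, h s ≤ g s) (hhe : ∀ s ∈ Icc 0 t, -e ≤ h s) :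
    ∫ s in (0 : ℝ)..t, heatK (t - s) (g s) ≤ (∫ s in (0 : ℝ)..t, heatK (t - s) (h s)) + 8 * e := by
  have hi := intervalIntegrable_heatK_path ht hh
  have hc : IntervalIntegrable (fun s => heatK (t - s) 0 - heatK (t - s) e) volume 0 t :=
    (intervalIntegrable_heatK_path ht continuousOn_const).sub
      (intervalIntegrable_heatK_path ht continuousOn_const)
  have := intervalIntegral.integral_mono_on ht (intervalIntegrable_heatK_path ht hg) (hi.add hc)
    (fun s hs => heatK_le_heatK_add (sub_nonneg.2 hs.2) (hgh s hs) (hhe s hs))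
  rw [intervalIntegral.integral_add hi hc] at this
  linarith [integral_heatK_zero_sub_le ht he]

theorem sub_le_nondecSemi {w : ℝ → ℝ} {T B : ℝ} (hB : ∀ t ∈ Icc 0 T, |w t| ≤ B) {t t' : ℝ}
    (h0 : 0 ≤ t) (htt' : t ≤ t') (ht' : t' ≤ T) : w t - w t' ≤ nondecSemi w T := by
  refine le_csSup ⟨B + B, ?_⟩ ⟨t, t', h0, htt', ht', rfl⟩
  rintro _ ⟨s, s', hs, hss', hs', rfl⟩
  linarith [le_abs_self (w s), neg_abs_le (w s'), hB s ⟨hs, hss'.trans hs'⟩,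
    hB s' ⟨hs.trans hss', hs'⟩]

theorem nondecSemi_nonneg {w : ℝ → ℝ} {T B : ℝ} (hT : 0 ≤ T) (hB : ∀ t ∈ Icc 0 T, |w t| ≤ B) :
    0 ≤ nondecSemi w T := by
  simpa using sub_le_nondecSemi hB le_rfl le_rfl hT

/-- Stability of the perturbed Stefan integral equation: if `w₁, w₂ ∈ C([0,T])` solve the
integral equation `∫₀^∞ p(t, wᵢ(t)-y) U_{**}(y) dy = fᵢ(t,wᵢ(t)) + ∫₀ᵗ p(t-s, wᵢ(t)-wᵢ(s)) ds`
on `(0,T]`, with `fᵢ` bounded measurable (bounded by `Mᵢ`) and `|wᵢ(t)| ≤ L - 1`, then with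
`ε := |w₁(0)| + M₁ + |w₁|' + |w₂(0)| + M₂ + |w₂|'` there is `C₁ = C₁(T,L)` such that
`ε ≤ 1/C₁` implies `sup_{[0,T]} (w₁ - w₂) ≤ C₁ ε`. -/
theorem stefan_integral_equation_stability (T : ℝ) (hT : 0 < T) (L : ℝ) :
    ∃ C₁ : ℝ, 0 < C₁ ∧
      ∀ (f₁ f₂ : ℝ → ℝ → ℝ) (M₁ M₂ : ℝ) (w₁ w₂ : ℝ → ℝ),
        Measurable (Function.uncurry f₁) → Measurable (Function.uncurry f₂) →
        (∀ t ∈ Set.Icc (0:ℝ) T, ∀ x : ℝ, |f₁ t x| ≤ M₁) →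
        (∀ t ∈ Set.Icc (0:ℝ) T, ∀ x : ℝ, |f₂ t x| ≤ M₂) →
        ContinuousOn w₁ (Set.Icc 0 T) → ContinuousOn w₂ (Set.Icc 0 T) →
        (∀ t ∈ Set.Ioc (0:ℝ) T,
          (∫ y in Set.Ioi (0:ℝ), heatK t (w₁ t - y) * Ustst y)
            = f₁ t (w₁ t) + ∫ s in (0:ℝ)..t, heatK (t - s) (w₁ t - w₁ s)) →
        (∀ t ∈ Set.Ioc (0:ℝ) T,
          (∫ y in Set.Ioi (0:ℝ), heatK t (w₂ t - y) * Ustst y)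
            = f₂ t (w₂ t) + ∫ s in (0:ℝ)..t, heatK (t - s) (w₂ t - w₂ s)) →
        (∀ t ∈ Set.Icc (0:ℝ) T, |w₁ t| ≤ L - 1) →
        (∀ t ∈ Set.Icc (0:ℝ) T, |w₂ t| ≤ L - 1) →
        ∀ ε : ℝ,
          ε = |w₁ 0| + M₁ + nondecSemi w₁ T + |w₂ 0| + M₂ + nondecSemi w₂ T →
          ε ≤ 1 / C₁ →
          ∀ t ∈ Set.Icc (0:ℝ) T, w₁ t - w₂ t ≤ C₁ * ε := by
  set A : ℝ := L + Real.sqrt T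
  set c : ℝ := 2 * gaussTail (1 / 2) A * ((Real.sqrt (2 * Real.pi))⁻¹ * Real.exp (-(1 / 2)))
  have hc : 0 < c := by
    have := gaussTail_pos (t := 1 / 2) (by norm_num) A
    positivity
  have hC : 0 < 10 / c + 2 := by positivity
  refine ⟨10 / c + 2, hC, ?_⟩
  intro f₁ f₂ M₁ M₂ w₁ w₂ _ _ hM₁ hM₂ hw₁ hw₂ he₁ he₂ hL₁ hL₂ ε hε _
  have h0 : (0 : ℝ) ∈ Icc 0 T := ⟨le_rfl, hT.le⟩
  have hM₁0 : 0 ≤ M₁ := (abs_nonneg _).trans (hM₁ 0 h0 0)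
  have hM₂0 : 0 ≤ M₂ := (abs_nonneg _).trans (hM₂ 0 h0 0)
  have hn₁ := nondecSemi_nonneg hT.le hL₁
  have hn₂ := nondecSemi_nonneg hT.le hL₂
  have ha₁ := abs_nonneg (w₁ 0)
  have ha₂ := abs_nonneg (w₂ 0)
  have hε0 : 0 ≤ ε := by linarith
  obtain ⟨t, ht, hmax⟩ := isCompact_Icc.exists_isMaxOn ⟨0, h0⟩ (hw₁.sub hw₂)
  have hmax' : ∀ s ∈ Icc 0 T, w₁ s - w₂ s ≤ w₁ t - w₂ t := fun s hs => hmax hs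
  suffices h : w₁ t - w₂ t ≤ (10 / c + 2) * ε from fun s hs => (hmax' s hs).trans h
  by_contra! hlt
  set δ := w₁ t - w₂ t with hδ
  set e := δ / (10 / c + 2) with he
  have hδe : δ = (10 / c + 2) * e := by rw [he]; field_simp
  have hεe : ε < e := by rw [he, lt_div_iff₀ hC]; linarith
  have he0 : 0 < e := hε0.trans_lt hεe
  have hδ0 : 2 * e < δ := by
    have : 0 < 10 / c * e := by positivity
    rw [hδe]; linarith
  have ht0 : 0 < t := by
    refine ht.1.lt_of_ne fun h => ?_
    rw [← h] at hδ
    linarith [le_abs_self (w₁ 0), neg_abs_le (w₂ 0)]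
  have hsub : Icc 0 t ⊆ Icc 0 T := Icc_subset_Icc_right ht.2
  have hpath := integral_heatK_path_le ht0.le he0
    (continuousOn_const.sub (hw₁.mono hsub)) (continuousOn_const.sub (hw₂.mono hsub))
    (g := fun s => w₁ t - w₁ s) (h := fun s => w₂ t - w₂ s)
    (fun s hs => by linarith [hmax' s (hsub hs)])
    (fun s hs => by linarith [sub_le_nondecSemi hL₂ hs.1 hs.2 ht.2])
  have hgap := le_integral_heatK_mul_Ustst_sub (x := w₂ t) (δ := δ) (A := A) ht0 (by linarith)
    (by linarith [sub_le_nondecSemi hL₂ le_rfl ht.1 ht.2, neg_abs_le (w₂ 0)])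
    (by linarith [Real.sqrt_le_sqrt ht.2, le_abs_self (w₁ t), hL₁ t ht])
  rw [show w₂ t + δ = w₁ t by rw [hδ]; ring, he₁ t ⟨ht0, ht.2⟩, he₂ t ⟨ht0, ht.2⟩] at hgap
  have hf₁ := (abs_le.1 (hM₁ t ht (w₁ t))).2
  have hf₂ := (abs_le.1 (hM₂ t ht (w₂ t))).1
  have hcδ : c * δ = 10 * e + 2 * (c * e) := by rw [hδe]; field_simp
  have : 0 < c * e := by positivity
  linarith
end
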